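/- Let u : ℝ³ → ℝ be a smooth function of (x, y, t) satisfying the 3D Pavlov equation u_yy = u_tx + u_y u_xx − u_x u_xy at every point, and let T : ℝ → ℝ be an arbitrary smooth function of t. Then each of the six functions φ₁ = 2x − y u_x, φ₂ = 3u − 2x u_x − y u_y, θ₀(T) = T u_t + T'(x u_x + y u_y − u) + ½ T''(y² u_x − 2xy) − (1/6) T''' y³, θ₁(T) = T u_y + T'(y u_x − x) − ½ T'' y², θ₂(T) = T u_x − T' y, and θ₃(T) = T satisfies the linearized Pavlov equation ℓ_E(φ) := φ_yy − φ_tx − u_y φ_xx + u_x φ_xy − u_xx φ_y + u_xy φ_x = 0 at every point of ℝ³. -/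

import Mathlib

noncomputable section

/-- Partial derivative with respect to the first variable (`x`). -/
def Dx (f : ℝ → ℝ → ℝ → ℝ) (x y t : ℝ) : ℝ := deriv (fun x' => f x' y t) x

/-- Partial derivative with respect to the second variable (`y`). -/
def Dy (f : ℝ → ℝ → ℝ → ℝ) (x y t : ℝ) : ℝ := deriv (fun y' => f x y' t) y

/-- Partial derivative with respect to the third variable (`t`). -/
def Dt (f : ℝ → ℝ → ℝ → ℝ) (x y t : ℝ) : ℝ := deriv (fun t' => f x y t') t

/-- Smoothness of a function of three real variables `(x, y, t)`. -/
def Smooth3 (f : ℝ → ℝ → ℝ → ℝ) : Prop :=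
  ContDiff ℝ (⊤ : ℕ∞) (fun p : ℝ × ℝ × ℝ => f p.1 p.2.1 p.2.2)

/-- Linearization of the Pavlov equation `u_yy = u_tx + u_y u_xx - u_x u_xy` at a solution `u`. -/
def linPavlov (u φ : ℝ → ℝ → ℝ → ℝ) (x y t : ℝ) : ℝ :=
  Dy (Dy φ) x y t - Dt (Dx φ) x y t - Dy u x y t * Dx (Dx φ) x y t
    + Dx u x y t * Dx (Dy φ) x y t - Dx (Dx u) x y t * Dy φ x y t
    + Dx (Dy u) x y t * Dx φ x y t

section Calculus

variable {f g : ℝ → ℝ → ℝ → ℝ}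

/-- The coordinate function `x`. -/
def coordX : ℝ → ℝ → ℝ → ℝ := fun x _ _ => x

/-- The coordinate function `y`. -/
def coordY : ℝ → ℝ → ℝ → ℝ := fun _ y _ => y

/-- A function of `t` alone, as a function of `(x, y, t)`. -/
def ofTime (a : ℝ → ℝ) : ℝ → ℝ → ℝ → ℝ := fun _ _ t => a t

/-- A constant function of `(x, y, t)`. -/
def const3 (c : ℝ) : ℝ → ℝ → ℝ → ℝ := fun _ _ _ => c

theorem smooth3_coordX : Smooth3 coordX := by
  unfold Smooth3 coordX; fun_prop

theorem smooth3_coordY : Smooth3 coordY := by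
  unfold Smooth3 coordY; fun_prop

theorem smooth3_const3 (c : ℝ) : Smooth3 (const3 c) := by
  unfold Smooth3 const3; fun_prop

theorem smooth3_ofTime {a : ℝ → ℝ} (ha : ContDiff ℝ (⊤ : ℕ∞) a) : Smooth3 (ofTime a) := by
  unfold Smooth3 ofTime; fun_prop

theorem Smooth3.add (hf : Smooth3 f) (hg : Smooth3 g) : Smooth3 (f + g) :=
  ContDiff.add hf hg

theorem Smooth3.sub (hf : Smooth3 f) (hg : Smooth3 g) : Smooth3 (f - g) :=
  ContDiff.sub hf hg

theorem Smooth3.mul (hf : Smooth3 f) (hg : Smooth3 g) : Smooth3 (f * g) :=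
  ContDiff.mul hf hg

theorem Smooth3.differentiable (hf : Smooth3 f) :
    Differentiable ℝ (fun p : ℝ × ℝ × ℝ => f p.1 p.2.1 p.2.2) :=
  ContDiff.differentiable hf (by simp)

theorem Smooth3.differentiableAt_x (hf : Smooth3 f) (x y t : ℝ) :
    DifferentiableAt ℝ (fun x' => f x' y t) x :=
  (hf.differentiable (x, y, t)).comp x (f := fun x' : ℝ => (x', y, t)) (by fun_prop)

theorem Smooth3.differentiableAt_y (hf : Smooth3 f) (x y t : ℝ) :
    DifferentiableAt ℝ (fun y' => f x y' t) y :=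
  (hf.differentiable (x, y, t)).comp y (f := fun y' : ℝ => (x, y', t)) (by fun_prop)

theorem Smooth3.differentiableAt_t (hf : Smooth3 f) (x y t : ℝ) :
    DifferentiableAt ℝ (fun t' => f x y t') t :=
  (hf.differentiable (x, y, t)).comp t (f := fun t' : ℝ => (x, y, t')) (by fun_prop)

theorem Smooth3.Dx_eq_fderiv (hf : Smooth3 f) (x y t : ℝ) :
    Dx f x y t = fderiv ℝ (fun p : ℝ × ℝ × ℝ => f p.1 p.2.1 p.2.2) (x, y, t) (1, 0, 0) :=
  (HasFDerivAt.comp_hasDerivAt x (f := fun x' : ℝ => (x', y, t))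
    (hf.differentiable (x, y, t)).hasFDerivAt
    ((hasDerivAt_id x).prodMk (hasDerivAt_const x (y, t)))).deriv

theorem Smooth3.Dy_eq_fderiv (hf : Smooth3 f) (x y t : ℝ) :
    Dy f x y t = fderiv ℝ (fun p : ℝ × ℝ × ℝ => f p.1 p.2.1 p.2.2) (x, y, t) (0, 1, 0) :=
  (HasFDerivAt.comp_hasDerivAt y (f := fun y' : ℝ => (x, y', t))
    (hf.differentiable (x, y, t)).hasFDerivAt
    ((hasDerivAt_const y x).prodMk ((hasDerivAt_id y).prodMk (hasDerivAt_const y t)))).deriv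

theorem Smooth3.Dt_eq_fderiv (hf : Smooth3 f) (x y t : ℝ) :
    Dt f x y t = fderiv ℝ (fun p : ℝ × ℝ × ℝ => f p.1 p.2.1 p.2.2) (x, y, t) (0, 0, 1) :=
  (HasFDerivAt.comp_hasDerivAt t (f := fun t' : ℝ => (x, y, t'))
    (hf.differentiable (x, y, t)).hasFDerivAt
    ((hasDerivAt_const t x).prodMk ((hasDerivAt_const t y).prodMk (hasDerivAt_id t)))).deriv

theorem contDiff_fderiv_apply_const {E : Type*} [NormedAddCommGroup E] [NormedSpace ℝ E]
    {F : E → ℝ} (hF : ContDiff ℝ (⊤ : ℕ∞) F) (v : E) :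
    ContDiff ℝ (⊤ : ℕ∞) (fun p => fderiv ℝ F p v) :=
  (hF.fderiv_right (m := (⊤ : ℕ∞)) (by simp)).clm_apply contDiff_const

theorem fderiv_fderiv_apply_comm {E : Type*} [NormedAddCommGroup E] [NormedSpace ℝ E]
    {F : E → ℝ} (hF : ContDiff ℝ (⊤ : ℕ∞) F) (v w p : E) :
    fderiv ℝ (fun q => fderiv ℝ F q v) p w = fderiv ℝ (fun q => fderiv ℝ F q w) p v := by
  have hd : DifferentiableAt ℝ (fderiv ℝ F) p :=
    (hF.fderiv_right (m := (⊤ : ℕ∞)) (by simp)).differentiable (by simp) p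
  have hs : IsSymmSndFDerivAt ℝ F p :=
    hF.contDiffAt.isSymmSndFDerivAt (by
      simpa using WithTop.coe_le_coe.2 (le_top : (2 : ℕ∞) ≤ ⊤))
  rw [fderiv_clm_apply hd (differentiableAt_const v),
    fderiv_clm_apply hd (differentiableAt_const w)]
  simpa using hs w v

theorem Smooth3.Dx (hf : Smooth3 f) : Smooth3 (Dx f) := by
  simpa only [Smooth3, hf.Dx_eq_fderiv] using contDiff_fderiv_apply_const hf (1, 0, 0)

theorem Smooth3.Dy (hf : Smooth3 f) : Smooth3 (Dy f) := by
  simpa only [Smooth3, hf.Dy_eq_fderiv] using contDiff_fderiv_apply_const hf (0, 1, 0)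

theorem Smooth3.Dt (hf : Smooth3 f) : Smooth3 (Dt f) := by
  simpa only [Smooth3, hf.Dt_eq_fderiv] using contDiff_fderiv_apply_const hf (0, 0, 1)

theorem Dy_Dx_comm (hf : Smooth3 f) : Dy (Dx f) = Dx (Dy f) := by
  funext x y t
  simp only [hf.Dx.Dy_eq_fderiv, hf.Dy.Dx_eq_fderiv, hf.Dx_eq_fderiv, hf.Dy_eq_fderiv]
  exact fderiv_fderiv_apply_comm hf _ _ _

theorem Dt_Dx_comm (hf : Smooth3 f) : Dt (Dx f) = Dx (Dt f) := by
  funext x y t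
  simp only [hf.Dx.Dt_eq_fderiv, hf.Dt.Dx_eq_fderiv, hf.Dx_eq_fderiv, hf.Dt_eq_fderiv]
  exact fderiv_fderiv_apply_comm hf _ _ _

theorem Dt_Dy_comm (hf : Smooth3 f) : Dt (Dy f) = Dy (Dt f) := by
  funext x y t
  simp only [hf.Dy.Dt_eq_fderiv, hf.Dt.Dy_eq_fderiv, hf.Dy_eq_fderiv, hf.Dt_eq_fderiv]
  exact fderiv_fderiv_apply_comm hf _ _ _

theorem Dx_add (hf : Smooth3 f) (hg : Smooth3 g) : Dx (f + g) = Dx f + Dx g := by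
  funext x y t
  exact deriv_fun_add (hf.differentiableAt_x x y t) (hg.differentiableAt_x x y t)

theorem Dx_sub (hf : Smooth3 f) (hg : Smooth3 g) : Dx (f - g) = Dx f - Dx g := by
  funext x y t
  exact deriv_fun_sub (hf.differentiableAt_x x y t) (hg.differentiableAt_x x y t)

theorem Dx_mul (hf : Smooth3 f) (hg : Smooth3 g) :
    Dx (f * g) = Dx f * g + f * Dx g := by
  funext x y t
  exact deriv_fun_mul (hf.differentiableAt_x x y t) (hg.differentiableAt_x x y t)

theorem Dy_add (hf : Smooth3 f) (hg : Smooth3 g) : Dy (f + g) = Dy f + Dy g := by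
  funext x y t
  exact deriv_fun_add (hf.differentiableAt_y x y t) (hg.differentiableAt_y x y t)

theorem Dy_sub (hf : Smooth3 f) (hg : Smooth3 g) : Dy (f - g) = Dy f - Dy g := by
  funext x y t
  exact deriv_fun_sub (hf.differentiableAt_y x y t) (hg.differentiableAt_y x y t)

theorem Dy_mul (hf : Smooth3 f) (hg : Smooth3 g) :
    Dy (f * g) = Dy f * g + f * Dy g := by
  funext x y t
  exact deriv_fun_mul (hf.differentiableAt_y x y t) (hg.differentiableAt_y x y t)

theorem Dt_add (hf : Smooth3 f) (hg : Smooth3 g) : Dt (f + g) = Dt f + Dt g := by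
  funext x y t
  exact deriv_fun_add (hf.differentiableAt_t x y t) (hg.differentiableAt_t x y t)

theorem Dt_sub (hf : Smooth3 f) (hg : Smooth3 g) : Dt (f - g) = Dt f - Dt g := by
  funext x y t
  exact deriv_fun_sub (hf.differentiableAt_t x y t) (hg.differentiableAt_t x y t)

theorem Dt_mul (hf : Smooth3 f) (hg : Smooth3 g) :
    Dt (f * g) = Dt f * g + f * Dt g := by
  funext x y t
  exact deriv_fun_mul (hf.differentiableAt_t x y t) (hg.differentiableAt_t x y t)

theorem Dx_coordX : Dx coordX = const3 1 := by
  funext x y t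
  exact deriv_id x

theorem Dx_coordY : Dx coordY = const3 0 := by
  funext x y t
  exact deriv_const x _

theorem Dx_ofTime (a : ℝ → ℝ) : Dx (ofTime a) = const3 0 := by
  funext x y t
  exact deriv_const x _

theorem Dx_const3 (c : ℝ) : Dx (const3 c) = const3 0 := by
  funext x y t
  exact deriv_const x c

theorem Dy_coordX : Dy coordX = const3 0 := by
  funext x y t
  exact deriv_const y _

theorem Dy_coordY : Dy coordY = const3 1 := by
  funext x y t
  exact deriv_id y

theorem Dy_ofTime (a : ℝ → ℝ) : Dy (ofTime a) = const3 0 := by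
  funext x y t
  exact deriv_const y _

theorem Dy_const3 (c : ℝ) : Dy (const3 c) = const3 0 := by
  funext x y t
  exact deriv_const y c

theorem Dt_coordX : Dt coordX = const3 0 := by
  funext x y t
  exact deriv_const t _

theorem Dt_coordY : Dt coordY = const3 0 := by
  funext x y t
  exact deriv_const t _

theorem Dt_ofTime (a : ℝ → ℝ) : Dt (ofTime a) = ofTime (deriv a) := rfl

theorem Dt_const3 (c : ℝ) : Dt (const3 c) = const3 0 := by
  funext x y t
  exact deriv_const t c

end Calculus

/-- Local symmetries of the 3D Pavlov equation. -/
theorem pavlov_local_symmetries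
    (u : ℝ → ℝ → ℝ → ℝ) (hu : Smooth3 u)
    (husol : ∀ x y t : ℝ, Dy (Dy u) x y t = Dt (Dx u) x y t + Dy u x y t * Dx (Dx u) x y t - Dx u x y t * Dx (Dy u) x y t)
    (T : ℝ → ℝ) (hT : ContDiff ℝ (⊤ : ℕ∞) T) :
    (∀ x y t : ℝ,
      linPavlov u (fun x y t => 2 * x - y * Dx u x y t) x y t = 0) ∧
    (∀ x y t : ℝ,
      linPavlov u (fun x y t => 3 * u x y t - 2 * x * Dx u x y t - y * Dy u x y t) x y t = 0) ∧
    (∀ x y t : ℝ,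
      linPavlov u (fun x y t =>
        T t * Dt u x y t + deriv T t * (x * Dx u x y t + y * Dy u x y t - u x y t)
          + (1 / 2) * deriv (deriv T) t * (y ^ 2 * Dx u x y t - 2 * x * y)
          - (1 / 6) * deriv (deriv (deriv T)) t * y ^ 3) x y t = 0) ∧
    (∀ x y t : ℝ,
      linPavlov u (fun x y t =>
        T t * Dy u x y t + deriv T t * (y * Dx u x y t - x)
          - (1 / 2) * deriv (deriv T) t * y ^ 2) x y t = 0) ∧
    (∀ x y t : ℝ,
      linPavlov u (fun x y t => T t * Dx u x y t - deriv T t * y) x y t = 0) ∧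
    (∀ x y t : ℝ,
      linPavlov u (fun x y t => T t) x y t = 0) := by
  have hT1 : ContDiff ℝ (⊤ : ℕ∞) (deriv T) := (contDiff_infty_iff_deriv.1 hT).2
  have hT2 : ContDiff ℝ (⊤ : ℕ∞) (deriv (deriv T)) := (contDiff_infty_iff_deriv.1 hT1).2
  have hT3 : ContDiff ℝ (⊤ : ℕ∞) (deriv (deriv (deriv T))) := (contDiff_infty_iff_deriv.1 hT2).2
  have hE : Dy (Dy u) = Dx (Dt u) + Dy u * Dx (Dx u) - Dx u * Dx (Dy u) := by
    funext x y t
    rw [husol, Dt_Dx_comm hu]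
    rfl
  have hEx (x y t : ℝ) := congrFun (congrFun (congrFun (congrArg Dx hE) x) y) t
  have hEy (x y t : ℝ) := congrFun (congrFun (congrFun (congrArg Dy hE) x) y) t
  have hEt (x y t : ℝ) := congrFun (congrFun (congrFun (congrArg Dt hE) x) y) t
  have hφ₁ : (fun x y t => 2 * x - y * Dx u x y t) =
      const3 2 * coordX - coordY * Dx u := rfl
  have hφ₂ : (fun x y t => 3 * u x y t - 2 * x * Dx u x y t - y * Dy u x y t) =
      const3 3 * u - const3 2 * coordX * Dx u - coordY * Dy u := rfl
  have hθ₀ : (fun x y t =>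
        T t * Dt u x y t + deriv T t * (x * Dx u x y t + y * Dy u x y t - u x y t)
          + (1 / 2) * deriv (deriv T) t * (y ^ 2 * Dx u x y t - 2 * x * y)
          - (1 / 6) * deriv (deriv (deriv T)) t * y ^ 3) =
      ofTime T * Dt u + ofTime (deriv T) * (coordX * Dx u + coordY * Dy u - u)
      + const3 (1 / 2) * ofTime (deriv (deriv T)) *
        (coordY * coordY * Dx u - const3 2 * coordX * coordY)
      - const3 (1 / 6) * ofTime (deriv (deriv (deriv T))) * (coordY * coordY * coordY) := by
    funext x y t
    simp only [coordX, coordY, ofTime, const3, Pi.add_apply, Pi.sub_apply, Pi.mul_apply]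
    ring
  have hθ₁ : (fun x y t =>
        T t * Dy u x y t + deriv T t * (y * Dx u x y t - x)
          - (1 / 2) * deriv (deriv T) t * y ^ 2) =
      ofTime T * Dy u + ofTime (deriv T) * (coordY * Dx u - coordX)
      - const3 (1 / 2) * ofTime (deriv (deriv T)) * (coordY * coordY) := by
    funext x y t
    simp only [coordX, coordY, ofTime, const3, Pi.add_apply, Pi.sub_apply, Pi.mul_apply]
    ring
  have hθ₂ : (fun x y t => T t * Dx u x y t - deriv T t * y) =
      ofTime T * Dx u - ofTime (deriv T) * coordY := rfl
  have hθ₃ : (fun _ _ t => T t) = ofTime T := rfl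
  rw [hφ₁, hφ₂, hθ₀, hθ₁, hθ₂, hθ₃]
  simp (maxDischargeDepth := 12) only [Dx_add, Dx_sub, Dx_mul, Dx_coordX, Dx_coordY,
    Dx_ofTime, Dx_const3, Dy_add, Dy_sub, Dy_mul,
    Dy_coordX, Dy_coordY, Dy_ofTime, Dy_const3, Dt_add, Dt_sub, Dt_mul, Dt_coordX, Dt_coordY,
    Dt_ofTime, Dt_const3, Dy_Dx_comm, Dt_Dx_comm, Dt_Dy_comm, Smooth3.add, Smooth3.sub,
    Smooth3.mul, Smooth3.Dx, Smooth3.Dy, Smooth3.Dt, smooth3_coordX, smooth3_coordY,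
    smooth3_const3, smooth3_ofTime, linPavlov, hu, hT, hT1, hT2, hT3, Pi.add_apply,
    Pi.sub_apply, Pi.mul_apply] at husol hEx hEy hEt ⊢
  simp only [coordX, coordY, ofTime, const3]
  refine ⟨fun x y t => ?_, fun x y t => ?_, fun x y t => ?_, fun x y t => ?_, fun x y t => ?_,
    fun x y t => ?_⟩
  · linear_combination -y * hEx x y t
  · linear_combination -2 * x * hEx x y t - y * hEy x y t + husol x y t
  · linear_combination T t * hEt x y t + deriv T t * (x * hEx x y t + y * hEy x y t + husol x y t)
      + (1 / 2) * deriv (deriv T) t * y ^ 2 * hEx x y t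
  · linear_combination T t * hEy x y t + deriv T t * y * hEx x y t
  · linear_combination T t * hEx x y t
  · ring
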